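/- arXiv:1802.01107 — 2 statements merged into one kernel-verified Lean document; each statement's English description precedes it below -/
import Mathlib

section
/- If (x₁,x₂,x₃) is a letter-thin triple, then both (α(x₁),α(x₂),α(x₃)) and (β(x₁),β(x₂),β(x₃)) are letter-thin triples. -/
open FreeGroup

abbrev W : Type := FreeGroup (Fin 2)

def Alt : Set W := {w | List.Chain' (fun p q : Fin 2 × Bool => p.1 ≠ q.1) w.toWord}

/-- The word map underlying `α`: repeatedly merge two consecutive `a`-letters of the
same sign across the single `b`-letter separating them (replacing each block of the
`a`-decomposition lying in `S_a⁺` by `a` and each block in `S_a⁻` by `a⁻¹`). -/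
def goA : List (Fin 2 × Bool) → List (Fin 2 × Bool)
  | x :: y :: z :: rest =>
      if x.1 = 0 ∧ y.1 = 1 ∧ z.1 = 0 ∧ x.2 = z.2 then goA (x :: rest)
      else x :: goA (y :: z :: rest)
  | l => l
termination_by l => l.length

/-- The word map underlying `β`. -/
def goB : List (Fin 2 × Bool) → List (Fin 2 × Bool)
  | x :: y :: z :: rest =>
      if x.1 = 1 ∧ y.1 = 0 ∧ z.1 = 1 ∧ x.2 = z.2 then goB (x :: rest)
      else x :: goB (y :: z :: rest)
  | l => l
termination_by l => l.length

/-- The map `α : 𝒜 → 𝒜`. -/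
def alphaF (w : W) : W := FreeGroup.mk (goA w.toWord)

/-- The map `β : 𝒜 → 𝒜`. -/
def betaF (w : W) : W := FreeGroup.mk (goB w.toWord)

/-- The automorphism `φ_a : a ↦ a⁻¹, b ↦ b` of `F₂`. -/
def phiaF : W →* W :=
  FreeGroup.lift (fun i : Fin 2 => if i = 0 then (FreeGroup.of (0 : Fin 2))⁻¹ else FreeGroup.of 1)

/-- The automorphism `φ_b : a ↦ a, b ↦ b⁻¹` of `F₂`. -/
def phibF : W →* W :=
  FreeGroup.lift (fun i : Fin 2 => if i = 0 then FreeGroup.of 0 else (FreeGroup.of (1 : Fin 2))⁻¹)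

/-- Generating moves for the equivalence relation `∼` on triples:
rotation, inversion, and the sign-change automorphisms `φ_a`, `φ_b`. -/
def TripleBase : W × W × W → W × W × W → Prop := fun t t' =>
  t' = (t.2.1, t.2.2, t.1) ∨
  t' = ((t.2.2)⁻¹, (t.2.1)⁻¹, (t.1)⁻¹) ∨
  t' = (phiaF t.1, phiaF t.2.1, phiaF t.2.2) ∨
  t' = (phibF t.1, phibF t.2.1, phibF t.2.2)

/-- The equivalence relation `∼` on triples of elements of `F₂`. -/
def TripleEquiv : W × W × W → W × W × W → Prop := Relation.EqvGen TripleBase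

/-- Form [T1a]: `(c₁⁻¹ a b c₂, c₂⁻¹ b⁻¹ a c₃, c₃⁻¹ a⁻¹ c₁)`, all words reduced. -/
def FormT1a (y₁ y₂ y₃ : W) : Prop :=
  ∃ c₁ c₂ c₃ : W, c₁ ∈ Alt ∧ c₂ ∈ Alt ∧ c₃ ∈ Alt ∧
    y₁.toWord = (c₁⁻¹).toWord ++ [((0 : Fin 2), true), ((1 : Fin 2), true)] ++ c₂.toWord ∧
    y₂.toWord = (c₂⁻¹).toWord ++ [((1 : Fin 2), false), ((0 : Fin 2), true)] ++ c₃.toWord ∧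
    y₃.toWord = (c₃⁻¹).toWord ++ [((0 : Fin 2), false)] ++ c₁.toWord

/-- Form [T1b]: `(c₁⁻¹ b a c₂, c₂⁻¹ a⁻¹ b c₃, c₃⁻¹ b⁻¹ c₁)`, all words reduced. -/
def FormT1b (y₁ y₂ y₃ : W) : Prop :=
  ∃ c₁ c₂ c₃ : W, c₁ ∈ Alt ∧ c₂ ∈ Alt ∧ c₃ ∈ Alt ∧
    y₁.toWord = (c₁⁻¹).toWord ++ [((1 : Fin 2), true), ((0 : Fin 2), true)] ++ c₂.toWord ∧
    y₂.toWord = (c₂⁻¹).toWord ++ [((0 : Fin 2), false), ((1 : Fin 2), true)] ++ c₃.toWord ∧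
    y₃.toWord = (c₃⁻¹).toWord ++ [((1 : Fin 2), false)] ++ c₁.toWord

/-- Form [T2a]: `(c₁⁻¹ b⁻¹ a b c₂, c₂⁻¹ b⁻¹, b c₁)`, all words reduced. -/
def FormT2a (y₁ y₂ y₃ : W) : Prop :=
  ∃ c₁ c₂ : W, c₁ ∈ Alt ∧ c₂ ∈ Alt ∧
    y₁.toWord = (c₁⁻¹).toWord ++
      [((1 : Fin 2), false), ((0 : Fin 2), true), ((1 : Fin 2), true)] ++ c₂.toWord ∧
    y₂.toWord = (c₂⁻¹).toWord ++ [((1 : Fin 2), false)] ∧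
    y₃.toWord = [((1 : Fin 2), true)] ++ c₁.toWord

/-- Form [T2b]: `(c₁⁻¹ a⁻¹ b a c₂, c₂⁻¹ a⁻¹, a c₁)`, all words reduced. -/
def FormT2b (y₁ y₂ y₃ : W) : Prop :=
  ∃ c₁ c₂ : W, c₁ ∈ Alt ∧ c₂ ∈ Alt ∧
    y₁.toWord = (c₁⁻¹).toWord ++
      [((0 : Fin 2), false), ((1 : Fin 2), true), ((0 : Fin 2), true)] ++ c₂.toWord ∧
    y₂.toWord = (c₂⁻¹).toWord ++ [((0 : Fin 2), false)] ∧
    y₃.toWord = [((0 : Fin 2), true)] ++ c₁.toWord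

/-- A triple of alternating words is letter-thin if it is `∼`-equivalent to a triple
of one of the forms [T1a], [T1b], [T2a], [T2b]. -/
def LetterThin (x₁ x₂ x₃ : W) : Prop :=
  x₁ ∈ Alt ∧ x₂ ∈ Alt ∧ x₃ ∈ Alt ∧
  ∃ y₁ y₂ y₃ : W, TripleEquiv (x₁, x₂, x₃) (y₁, y₂, y₃) ∧
    (FormT1a y₁ y₂ y₃ ∨ FormT1b y₁ y₂ y₃ ∨ FormT2a y₁ y₂ y₃ ∨ FormT2b y₁ y₂ y₃)

namespace LThin

abbrev Ltr := Fin 2 × Bool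
abbrev AltL (l : List Ltr) : Prop := l.IsChain (fun p q => p.1 ≠ q.1)

/-- Tail of `goA` after an `a`-letter of sign `s`. -/
def ff : Bool → List Ltr → List Ltr
  | s, y :: z :: rest => if z.2 = s then ff s rest else y :: z :: ff z.2 rest
  | _, l => l

theorem goA_nil : goA [] = [] := by unfold goA; rfl
theorem goA_single (x : Ltr) : goA [x] = [x] := by unfold goA; rfl
theorem goA_pair (x y : Ltr) : goA [x, y] = [x, y] := by unfold goA; rfl
theorem goA_ccc (x y z : Ltr) (r : List Ltr) : goA (x :: y :: z :: r) =
    if x.1 = 0 ∧ y.1 = 1 ∧ z.1 = 0 ∧ x.2 = z.2 then goA (x :: r) else x :: goA (y :: z :: r) := by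
  rw [goA]

theorem goA_one (t : Bool) (v : List Ltr) : goA ((1, t) :: v) = (1, t) :: goA v := by
  match v with
  | [] => simp [goA_nil, goA_single]
  | [y] => simp [goA_pair, goA_single]
  | y :: z :: r => simp [goA_ccc (1, t)]

theorem fin_of_ne_zero {i : Fin 2} (h : ¬ (0 : Fin 2) = i) : i = 1 := by omega
theorem fin_of_ne_one {i : Fin 2} (h : ¬ (1 : Fin 2) = i) : i = 0 := by omega

theorem alt_tail {x : Ltr} {l : List Ltr} (h : AltL (x :: l)) : AltL l :=
  h.infix ⟨[x], [], by simp⟩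

theorem alt_one_of_zero {s : Bool} {y : Ltr} {l : List Ltr} (h : AltL ((0, s) :: y :: l)) :
    ∃ t, y = (1, t) := by
  obtain ⟨i, t⟩ := y
  have := (List.isChain_cons_cons.1 h).1
  obtain rfl : i = 1 := fin_of_ne_zero this
  exact ⟨t, rfl⟩

theorem alt_zero_of_one {s : Bool} {y : Ltr} {l : List Ltr} (h : AltL ((1, s) :: y :: l)) :
    ∃ t, y = (0, t) := by
  obtain ⟨i, t⟩ := y
  have := (List.isChain_cons_cons.1 h).1
  obtain rfl : i = 0 := fin_of_ne_one this
  exact ⟨t, rfl⟩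

theorem alt_change {s t : Bool} {i : Fin 2} {l : List Ltr} (h : AltL ((i, s) :: l)) :
    AltL ((i, t) :: l) := by
  cases l with
  | nil => simp
  | cons y l => simpa using h

theorem goA_zero : ∀ (v : List Ltr) (s : Bool), AltL ((0, s) :: v) →
    goA ((0, s) :: v) = (0, s) :: ff s v
  | [], s, _ => by simp [goA_single, ff]
  | [y], s, _ => by simp [goA_pair, ff]
  | y :: z :: r, s, h => by
    obtain ⟨t, rfl⟩ := alt_one_of_zero h
    obtain ⟨q, rfl⟩ := alt_zero_of_one (alt_tail h)
    have h2 := alt_tail (alt_tail h)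
    rw [goA_ccc]
    by_cases hq : s = q
    · subst hq
      simp [ff, goA_zero r s h2]
    · have hq' : ¬ q = s := fun e => hq e.symm
      simp [ff, hq, hq', goA_one, goA_zero r q h2]

theorem ff_split : ∀ (u : List Ltr) (r s : Bool) (v : List Ltr), AltL ((0, r) :: (u ++ (0, s) :: v)) →
    ff r (u ++ (0, s) :: v) = ff r (u ++ [(0, s)]) ++ ff s v
  | [], r, s, v, h => by simp at h
  | [y], r, s, v, h => by
    by_cases hs : s = r <;> simp [ff, hs]
  | y :: z :: u, r, s, v, h => by
    obtain ⟨t, rfl⟩ := alt_one_of_zero h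
    obtain ⟨q, rfl⟩ := alt_zero_of_one (alt_tail h)
    have h2 := alt_tail (alt_tail h)
    have := ff_split u q s v h2
    by_cases hs : q = r
    · subst hs; simp [ff, this]
    · simp [ff, hs, this]

theorem goA_split (u : List Ltr) (s : Bool) (v : List Ltr) (h : AltL (u ++ (0, s) :: v)) :
    goA (u ++ (0, s) :: v) = goA (u ++ [(0, s)]) ++ ff s v := by
  induction u with
  | nil => simpa [goA_single] using goA_zero v s h
  | cons x u ih =>
    obtain ⟨i, t⟩ := x
    rw [List.cons_append] at h
    have h2 := alt_tail h
    by_cases hi : i = 0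
    · subst hi
      have h3 : AltL ((0, t) :: (u ++ [(0, s)])) := h.infix ⟨[], v, by simp⟩
      rw [List.cons_append, goA_zero _ _ h, List.cons_append, goA_zero _ _ h3, ff_split _ _ _ _ h]
      simp
    · obtain rfl : i = 1 := by omega
      rw [List.cons_append, goA_one, List.cons_append, goA_one, ih h2]
      simp

theorem inv_cons (i : Fin 2) (s : Bool) (l : List Ltr) :
    invRev ((i, s) :: l) = invRev l ++ [(i, !s)] := by simp [invRev]

theorem alt_inv {l : List Ltr} (h : AltL l) : AltL (invRev l) := by
  unfold AltL invRev
  rw [List.isChain_reverse, List.isChain_map]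
  exact h.imp (fun a b hab => hab.symm)

theorem goA_inv : ∀ l : List Ltr, AltL l → goA (invRev l) = invRev (goA l)
  | [], _ => by simp [goA_nil]
  | [x], _ => by simp [goA_single, invRev]
  | [x, y], _ => by simp [goA_pair, invRev]
  | (i, p) :: y :: z :: r, h => by
    have hi := alt_inv h
    have h2 := alt_tail h
    have h3 := alt_tail h2
    by_cases h0 : i = 0
    · subst h0
      obtain ⟨t, rfl⟩ := alt_one_of_zero h
      obtain ⟨q, rfl⟩ := alt_zero_of_one h2
      have e : invRev ((0, p) :: (1, t) :: (0, q) :: r)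
        = invRev r ++ (0, !q) :: [(1, !t), (0, !p)] := by simp [inv_cons]
      have ih := goA_inv _ h3
      rw [inv_cons] at ih
      rw [e] at hi ⊢
      rw [goA_split _ _ _ hi, ih, goA_ccc]
      by_cases hq : p = q
      · subst hq; simp [ff]
      · simp [hq, ff, goA_one, inv_cons]
    · obtain rfl : i = 1 := by omega
      obtain ⟨t, rfl⟩ := alt_zero_of_one h
      have e : invRev ((1, p) :: (0, t) :: z :: r)
        = invRev (z :: r) ++ (0, !t) :: [(1, !p)] := by simp [inv_cons]
      have ih := goA_inv _ h2
      rw [inv_cons] at ih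
      rw [e] at hi ⊢
      rw [goA_split _ _ _ hi, ih, goA_one, inv_cons]
      simp [ff]

theorem goA_key (c : List Ltr) (s : Bool) (v : List Ltr) (h : AltL (invRev c ++ (0, s) :: v)) :
    goA (invRev c ++ (0, s) :: v) = invRev (ff (!s) c) ++ (0, s) :: ff s v := by
  have h1 : AltL (invRev c ++ [(0, s)]) := h.infix ⟨[], v, by simp⟩
  have h2 : AltL ((0, !s) :: c) := by simpa [inv_cons] using alt_inv h1
  have := goA_inv _ h2
  rw [goA_zero _ _ h2, inv_cons, inv_cons, Bool.not_not] at this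
  rw [goA_split _ _ _ h, this]
  simp

theorem ff_head : ∀ (v : List Ltr) (s : Bool), AltL ((0, s) :: v) →
    ff s v = [] ∨ ∃ t r, ff s v = (1, t) :: r
  | [], s, _ => by simp [ff]
  | [y], s, h => by
    obtain ⟨t, rfl⟩ := alt_one_of_zero h
    simp [ff]
  | y :: z :: r, s, h => by
    obtain ⟨t, rfl⟩ := alt_one_of_zero h
    obtain ⟨q, rfl⟩ := alt_zero_of_one (alt_tail h)
    have := ff_head r q (alt_tail (alt_tail h))
    by_cases hq : q = s
    · subst hq; simpa [ff] using this
    · simp [ff, hq]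

theorem alt_ff : ∀ (v : List Ltr) (s : Bool), AltL ((0, s) :: v) → AltL ((0, s) :: ff s v)
  | [], s, _ => by simp [ff]
  | [y], s, h => by simpa [ff] using h
  | y :: z :: r, s, h => by
    obtain ⟨t, rfl⟩ := alt_one_of_zero h
    obtain ⟨q, rfl⟩ := alt_zero_of_one (alt_tail h)
    have := alt_ff r q (alt_tail (alt_tail h))
    by_cases hq : q = s
    · subst hq; simpa [ff] using this
    · simpa [ff, hq] using this

theorem alt_goA (l : List Ltr) (h : AltL l) : AltL (goA l) := by
  match l with
  | [] => simp [goA_nil]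
  | (i, s) :: v =>
    by_cases h0 : i = 0
    · subst h0; rw [goA_zero _ _ h]; exact alt_ff _ _ h
    · obtain rfl : i = 1 := by omega
      rw [goA_one]
      match v with
      | [] => simp [goA_nil]
      | y :: v =>
        obtain ⟨q, rfl⟩ := alt_zero_of_one h
        rw [goA_zero _ _ (alt_tail h)]
        simpa using alt_ff _ _ (alt_tail h)

/-- Letter-thinness at the level of words. -/
inductive LT : List Ltr → List Ltr → List Ltr → Prop
  | t1 (i j : Fin 2) (s t : Bool) (h : i ≠ j) (c₁ c₂ c₃ : List Ltr) :
      LT (invRev c₁ ++ (i, s) :: (j, t) :: c₂) (invRev c₂ ++ (j, !t) :: (i, s) :: c₃)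
        (invRev c₃ ++ (i, !s) :: c₁)
  | t2 (i j : Fin 2) (s t : Bool) (h : i ≠ j) (c₁ c₂ : List Ltr) :
      LT (invRev c₁ ++ (i, !s) :: (j, t) :: (i, s) :: c₂) (invRev c₂ ++ [(i, !s)])
        ((i, s) :: c₁)
  | rot (x y z : List Ltr) (h : LT x y z) : LT y z x
  | inv (x y z : List Ltr) (h : LT x y z) : LT (invRev z) (invRev y) (invRev x)

theorem LT.map (f : Ltr → Ltr) (g : Fin 2 → Fin 2) (e : Fin 2 → Bool → Bool)
    (hf : ∀ i s, f (i, s) = (g i, e i s)) (he : ∀ i s, e i (!s) = !(e i s))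
    (hg : ∀ i j, i ≠ j → g i ≠ g j) {x y z : List Ltr} (h : LT x y z) :
    LT (x.map f) (y.map f) (z.map f) := by
  have hinv : ∀ l : List Ltr, (invRev l).map f = invRev (l.map f) := by
    intro l
    induction l with
    | nil => simp
    | cons x l ih => obtain ⟨i, s⟩ := x; simp [inv_cons, ih, hf, he]
  induction h with
  | t1 i j s t h c₁ c₂ c₃ => simpa [hf, he, hinv] using LT.t1 _ _ (e i s) (e j t) (hg _ _ h) _ _ _
  | t2 i j s t h c₁ c₂ => simpa [hf, he, hinv] using LT.t2 _ _ (e i s) (e j t) (hg _ _ h) _ _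
  | rot x y z h ih => exact ih.rot
  | inv x y z h ih => simpa [hinv] using ih.inv

theorem LT.core (s t : Bool) (p v r : List Ltr) (hp : p = [] ∨ ∃ q p', p = (1, q) :: p') :
    LT (invRev p ++ (0, s) :: v) (invRev v ++ (0, !s) :: (1, t) :: (0, s) :: r)
      (invRev r ++ (0, !s) :: p) := by
  have key : ∀ t p' v r, LT (invRev ((1, t) :: p') ++ (0, s) :: v)
      (invRev v ++ (0, !s) :: (1, t) :: (0, s) :: r) (invRev r ++ (0, !s) :: (1, t) :: p') := by
    intro t p' v r
    have := LT.t1 1 0 t s (by decide) ((0, s) :: v) r p'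
    simpa [inv_cons] using this.rot.rot
  rcases hp with rfl | ⟨q, p', rfl⟩
  · simpa using (LT.t2 0 1 s t (by decide) v r).rot.rot
  · by_cases hq : q = t
    · subst hq; exact key _ _ _ _
    · obtain rfl : q = !t := by cases q <;> cases t <;> simp_all
      simpa [inv_cons] using (key (!t) p' r v).inv

theorem alt_suffix {u v : List Ltr} (h : AltL (u ++ v)) : AltL v := h.infix ⟨u, [], by simp⟩
theorem alt_prefix {u v : List Ltr} (h : AltL (u ++ v)) : AltL u := h.infix ⟨[], v, by simp⟩

theorem LT.goA {x y z : List Ltr} (h : LT x y z) : AltL x → AltL y → AltL z →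
    LT (goA x) (goA y) (goA z) := by
  induction h with
  | rot x y z h ih => exact fun hy hz hx => (ih hx hy hz).rot
  | inv x y z h ih =>
    intro hz hy hx
    have hz := alt_inv hz
    have hy := alt_inv hy
    have hx := alt_inv hx
    rw [invRev_invRev] at hx hy hz
    rw [goA_inv _ hx, goA_inv _ hy, goA_inv _ hz]
    exact (ih hx hy hz).inv
  | t1 i j s t h c₁ c₂ c₃ =>
    intro hx hy hz
    by_cases h0 : i = 0
    · subst h0
      obtain rfl : j = 1 := by omega
      have hw₁ := ff_head c₁ (!s) (alt_suffix hz)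
      have hw₃ := ff_head c₃ s (alt_tail (alt_suffix hy))
      have hb := alt_tail (alt_suffix hx)
      have hy' : AltL (invRev ((1, t) :: c₂) ++ (0, s) :: c₃) := by simpa [inv_cons] using hy
      have ey := goA_key _ _ _ hy'
      rw [inv_cons, List.append_assoc, List.singleton_append] at ey
      rw [goA_key _ _ _ hx, ey, goA_key _ _ _ hz]
      generalize ff (!s) c₁ = w₁ at *
      rw [Bool.not_not]
      generalize ff s c₃ = w₃ at *
      cases c₂ with
      | nil => simpa [ff, inv_cons] using LT.t1 0 1 s t (by decide) w₁ [] w₃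
      | cons p d =>
        obtain ⟨q, rfl⟩ := alt_zero_of_one hb
        by_cases hq : q = s
        · subst hq
          simpa [ff, inv_cons] using LT.core q (!t) w₁ (ff q d) w₃ hw₁
        · obtain rfl : q = !s := by cases q <;> cases s <;> simp_all
          simpa [ff, inv_cons] using (LT.core (!s) (!t) w₃ (ff (!s) d) w₁ hw₃).rot.inv.rot.rot
    · obtain rfl : i = 1 := by omega
      obtain rfl : j = 0 := by omega
      have hw₂ := ff_head c₂ t (alt_tail (alt_suffix hx))
      have hc₃ := alt_tail (alt_suffix hy)
      have hc₁ := alt_suffix hz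
      have hx' : AltL (invRev ((1, !s) :: c₁) ++ (0, t) :: c₂) := by simpa [inv_cons] using hx
      have ex := goA_key _ _ _ hx'
      rw [inv_cons, List.append_assoc, List.singleton_append, Bool.not_not] at ex
      rw [ex, goA_key _ _ _ hy, Bool.not_not]
      generalize ff t c₂ = w₂ at *
      have bcases : ∀ p : Bool, p = t ∨ p = !t := by intro p; cases p <;> cases t <;> simp
      cases c₁ with
      | nil =>
        cases c₃ with
        | nil => simpa [ff, inv_cons, goA_single] using LT.t1 1 0 s t (by decide) [] w₂ []
        | cons q d₃ =>
          obtain ⟨q, rfl⟩ := alt_zero_of_one hc₃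
          have hz' : AltL (invRev d₃ ++ (0, !q) :: [(1, !s)]) := by simpa [inv_cons] using hz
          have ez := goA_key _ _ _ hz'
          rw [inv_cons, List.append_assoc, List.singleton_append, ez, Bool.not_not]
          rcases bcases q with rfl | rfl
          · simpa [ff, inv_cons] using LT.t1 1 0 s q (by decide) [] w₂ ((0, q) :: ff q d₃)
          · simpa [ff, inv_cons] using (LT.t1 0 1 t (!s) (by decide) (ff (!t) d₃) [] w₂).rot
      | cons p d₁ =>
        obtain ⟨p, rfl⟩ := alt_zero_of_one hc₁
        have hz' : AltL (invRev ((1, s) :: c₃) ++ (0, p) :: d₁) := by simpa [inv_cons] using hz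
        have ez := goA_key _ _ _ hz'
        rw [inv_cons, List.append_assoc, List.singleton_append] at ez
        rw [ez]
        have hu₁ := ff_head d₁ p (alt_tail hc₁)
        cases c₃ with
        | nil =>
          rcases bcases p with rfl | rfl
          · simpa [ff, inv_cons] using LT.t1 1 0 s p (by decide) ((0, p) :: ff p d₁) w₂ []
          · simpa [ff, inv_cons] using (LT.t1 0 1 t s (by decide) (ff (!t) d₁) [] w₂).inv
        | cons q d₃ =>
          obtain ⟨q, rfl⟩ := alt_zero_of_one hc₃
          have hu₃ := ff_head d₃ q (alt_tail hc₃)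
          rcases bcases p with rfl | rfl <;> rcases bcases q with rfl | rfl
          · simpa [ff, inv_cons] using
              LT.t1 1 0 s q (by decide) ((0, q) :: ff q d₁) w₂ ((0, q) :: ff q d₃)
          · simpa [ff, inv_cons] using (LT.core p s (ff (!p) d₃) (ff p d₁) w₂ hu₃).rot
          · simpa [ff, inv_cons] using LT.core q s (ff (!q) d₁) w₂ (ff q d₃) hu₁
          · simpa [ff, inv_cons] using
              (LT.core (!t) (!s) w₂ (ff (!t) d₃) (ff (!t) d₁) hw₂).rot.rot
  | t2 i j s t h c₁ c₂ =>
    intro hx hy hz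
    by_cases h0 : i = 0
    · subst h0
      obtain rfl : j = 1 := by omega
      have hy' : AltL (invRev c₂ ++ (0, !s) :: []) := hy
      rw [goA_key _ _ _ hx, goA_key _ _ _ hy', goA_zero _ _ hz]
      simpa [ff] using LT.t2 0 1 s t (by decide) (ff s c₁) (ff s c₂)
    · obtain rfl : i = 1 := by omega
      obtain rfl : j = 0 := by omega
      have bcases : ∀ p : Bool, p = t ∨ p = !t := by intro p; cases p <;> cases t <;> simp
      have hx' : AltL (invRev ((1, s) :: c₁) ++ (0, t) :: (1, s) :: c₂) := by
        simpa [inv_cons] using hx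
      have ex := goA_key _ _ _ hx'
      rw [inv_cons, List.append_assoc, List.singleton_append] at ex
      have hb : AltL ((1, s) :: c₂) := alt_tail (alt_tail (alt_suffix hx))
      have ey := goA_inv _ hb
      rw [inv_cons, goA_one] at ey
      rw [ex, ey, goA_one]
      cases c₁ with
      | nil =>
        cases c₂ with
        | nil => simpa [ff, inv_cons, goA_nil] using LT.t2 1 0 s t (by decide) [] []
        | cons q d₂ =>
          obtain ⟨q, rfl⟩ := alt_zero_of_one hb
          rw [goA_zero _ _ (alt_tail hb), goA_nil]
          rcases bcases q with rfl | rfl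
          · simpa [ff, inv_cons] using LT.t1 1 0 (!s) q (by decide) [] (ff q d₂) []
          · simpa [ff, inv_cons] using LT.t2 1 0 s t (by decide) [] ((0, !t) :: ff (!t) d₂)
      | cons p d₁ =>
        obtain ⟨p, rfl⟩ := alt_zero_of_one hz
        rw [goA_zero _ _ (alt_tail hz)]
        cases c₂ with
        | nil =>
          rw [goA_nil]
          rcases bcases p with rfl | rfl
          · simpa [ff, inv_cons] using LT.t2 1 0 s p (by decide) ((0, p) :: ff p d₁) []
          · simpa [ff, inv_cons] using
              (LT.t1 1 0 (!s) (!t) (by decide) [] (ff (!t) d₁) []).rot.inv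
        | cons q d₂ =>
          obtain ⟨q, rfl⟩ := alt_zero_of_one hb
          rw [goA_zero _ _ (alt_tail hb)]
          rcases bcases p with rfl | rfl <;> rcases bcases q with rfl | rfl
          · simpa [ff, inv_cons] using
              LT.t1 1 0 (!s) q (by decide) ((0, q) :: ff q d₁) (ff q d₂) []
          · simpa [ff, inv_cons] using
              LT.t2 1 0 s p (by decide) ((0, p) :: ff p d₁) ((0, !p) :: ff (!p) d₂)
          · simpa [ff, inv_cons] using
              (LT.t1 0 1 q (!s) (by decide) (ff (!q) d₁) [] (ff q d₂)).inv
          · simpa [ff, inv_cons] using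
              (LT.t1 1 0 (!s) (!t) (by decide) ((0, !t) :: ff (!t) d₂) (ff (!t) d₁) []).rot.inv

/-! ### The swap of the two generators -/

def sw (x : Ltr) : Ltr := (x.1 + 1, x.2)

theorem sw_sw (x : Ltr) : sw (sw x) = x := by
  obtain ⟨i, s⟩ := x
  have : i + 1 + 1 = i := by omega
  simp [sw, this]

theorem map_sw_sw (l : List Ltr) : (l.map sw).map sw = l := by
  simp [Function.comp_def, sw_sw]

theorem goB_eq (l : List Ltr) : goB l = (goA (l.map sw)).map sw := by
  fun_induction goB l with
  | case1 x y z r h ih =>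
    rw [ih]
    simp only [List.map_cons]
    rw [goA_ccc, if_pos]
    simp [sw, h.1, h.2.1, h.2.2.1, h.2.2.2]
  | case2 x y z r h ih =>
    rw [ih]
    simp only [List.map_cons]
    rw [goA_ccc, if_neg]
    · simp [sw_sw]
    · intro h'
      apply h
      simp only [sw] at h'
      refine ⟨?_, ?_, ?_, h'.2.2.2⟩ <;> omega
  | case3 l h =>
    match l, h with
    | [], _ => simp [goA_nil]
    | [x], _ => simp [goA_single, sw_sw]
    | [x, y], _ => simp [goA_pair, sw_sw]
    | x :: y :: z :: r, h => exact absurd rfl (h x y z r)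

theorem alt_map (f : Ltr → Ltr) (hf : ∀ x y, x.1 ≠ y.1 → (f x).1 ≠ (f y).1) {l : List Ltr}
    (h : AltL l) : AltL (l.map f) := by
  unfold AltL
  rw [List.isChain_map]
  exact h.imp (fun a b hab => hf a b hab)

theorem alt_sw {l : List Ltr} (h : AltL l) : AltL (l.map sw) :=
  alt_map sw (by intro x y h h'; simp only [sw] at h'; omega) h

theorem LT.sw {x y z : List Ltr} (h : LT x y z) : LT (x.map sw) (y.map sw) (z.map sw) :=
  h.map LThin.sw (fun i => i + 1) (fun _ s => s) (fun _ _ => rfl) (fun _ _ => rfl)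
    (by intro i j; omega)

theorem LT.goB {x y z : List Ltr} (h : LT x y z) (hx : AltL x) (hy : AltL y) (hz : AltL z) :
    LT (goB x) (goB y) (goB z) := by
  rw [goB_eq, goB_eq, goB_eq]
  exact (h.sw.goA (alt_sw hx) (alt_sw hy) (alt_sw hz)).sw

theorem alt_goB (l : List Ltr) (h : AltL l) : AltL (goB l) := by
  rw [goB_eq]; exact alt_sw (alt_goA _ (alt_sw h))

/-! ### Transfer to the free group -/

def fa (x : Ltr) : Ltr := (x.1, if x.1 = 0 then !x.2 else x.2)
def fb (x : Ltr) : Ltr := (x.1, if x.1 = 0 then x.2 else !x.2)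

theorem phia_mk (l : List Ltr) : phiaF (FreeGroup.mk l) = FreeGroup.mk (l.map fa) := by
  induction l with
  | nil => simp [← one_eq_mk]
  | cons x l ih =>
    have e : ∀ (x : Ltr) (l : List Ltr), FreeGroup.mk (x :: l) = FreeGroup.mk [x] * FreeGroup.mk l :=
      fun _ _ => rfl
    rw [e, _root_.map_mul, ih, List.map_cons, e (fa x)]
    congr 1
    obtain ⟨i, s⟩ := x
    fin_cases i <;> cases s <;> simp [phiaF, fa, FreeGroup.of, invRev]

theorem phib_mk (l : List Ltr) : phibF (FreeGroup.mk l) = FreeGroup.mk (l.map fb) := by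
  induction l with
  | nil => simp [← one_eq_mk]
  | cons x l ih =>
    have e : ∀ (x : Ltr) (l : List Ltr), FreeGroup.mk (x :: l) = FreeGroup.mk [x] * FreeGroup.mk l :=
      fun _ _ => rfl
    rw [e, _root_.map_mul, ih, List.map_cons, e (fb x)]
    congr 1
    obtain ⟨i, s⟩ := x
    fin_cases i <;> cases s <;> simp [phibF, fb, FreeGroup.of, invRev]

theorem toWord_mk_of_red {l : List Ltr} (h : IsReduced l) : (FreeGroup.mk l).toWord = l := by
  rw [toWord_mk, h.reduce_eq]

theorem red_of_alt {l : List Ltr} (h : AltL l) : IsReduced l :=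
  h.imp (fun _ _ hab e => absurd e hab)

theorem toWord_mk_of_alt {l : List Ltr} (h : AltL l) : (FreeGroup.mk l).toWord = l :=
  toWord_mk_of_red (red_of_alt h)

theorem red_map (f : Ltr → Ltr) (hf : ∀ x y : Ltr, (x.1 = y.1 → x.2 = y.2) →
    ((f x).1 = (f y).1 → (f x).2 = (f y).2)) {l : List Ltr} (h : IsReduced l) :
    IsReduced (l.map f) := by
  unfold FreeGroup.IsReduced
  rw [List.isChain_map]
  exact h.imp (fun a b hab => hf a b hab)

theorem toWord_phia (x : W) : (phiaF x).toWord = x.toWord.map fa := by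
  conv_lhs => rw [← mk_toWord (x := x), phia_mk]
  apply toWord_mk_of_red
  apply red_map _ _ isReduced_toWord
  intro x y h e
  simp only [fa] at e ⊢
  rw [e, h e]

theorem toWord_phib (x : W) : (phibF x).toWord = x.toWord.map fb := by
  conv_lhs => rw [← mk_toWord (x := x), phib_mk]
  apply toWord_mk_of_red
  apply red_map _ _ isReduced_toWord
  intro x y h e
  simp only [fb] at e ⊢
  rw [e, h e]

theorem fa_fa (x : Ltr) : fa (fa x) = x := by
  obtain ⟨i, s⟩ := x
  fin_cases i <;> simp [fa]

theorem fb_fb (x : Ltr) : fb (fb x) = x := by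
  obtain ⟨i, s⟩ := x
  fin_cases i <;> simp [fb]

theorem LT.fa {x y z : List Ltr} (h : LT x y z) : LT (x.map fa) (y.map fa) (z.map fa) :=
  h.map LThin.fa id (fun i s => if i = 0 then !s else s) (fun _ _ => rfl)
    (by intro i s; split <;> rfl) (fun _ _ h => h)

theorem LT.fb {x y z : List Ltr} (h : LT x y z) : LT (x.map fb) (y.map fb) (z.map fb) :=
  h.map LThin.fb id (fun i s => if i = 0 then s else !s) (fun _ _ => rfl)
    (by intro i s; split <;> rfl) (fun _ _ h => h)

def LTW (t : W × W × W) : Prop := LT t.1.toWord t.2.1.toWord t.2.2.toWord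

theorem LTW_base {t t' : W × W × W} (h : TripleBase t t') : LTW t ↔ LTW t' := by
  obtain ⟨x, y, z⟩ := t
  rcases h with rfl | rfl | rfl | rfl
  · exact ⟨fun h => h.rot, fun h => h.rot.rot⟩
  · simp only [LTW, toWord_inv]
    exact ⟨fun h => h.inv, fun h => by simpa using h.inv⟩
  · simp only [LTW, toWord_phia]
    exact ⟨fun h => h.fa, fun h => by simpa [Function.comp_def, fa_fa] using h.fa⟩
  · simp only [LTW, toWord_phib]
    exact ⟨fun h => h.fb, fun h => by simpa [Function.comp_def, fb_fb] using h.fb⟩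

theorem LTW_equiv {t t' : W × W × W} (h : TripleEquiv t t') : LTW t ↔ LTW t' := by
  induction h with
  | rel _ _ h => exact LTW_base h
  | refl => exact Iff.rfl
  | symm _ _ _ ih => exact ih.symm
  | trans _ _ _ _ _ ih₁ ih₂ => exact ih₁.trans ih₂

theorem LT_of_letterThin {x y z : W} (h : LetterThin x y z) : LTW (x, y, z) := by
  obtain ⟨-, -, -, y₁, y₂, y₃, he, hf⟩ := h
  rw [LTW_equiv he]
  unfold LTW
  rcases hf with ⟨c₁, c₂, c₃, -, -, -, e₁, e₂, e₃⟩ | ⟨c₁, c₂, c₃, -, -, -, e₁, e₂, e₃⟩ |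
    ⟨c₁, c₂, -, -, e₁, e₂, e₃⟩ | ⟨c₁, c₂, -, -, e₁, e₂, e₃⟩
  · simpa [e₁, e₂, e₃, toWord_inv] using LT.t1 0 1 true true (by decide) c₁.toWord c₂.toWord c₃.toWord
  · simpa [e₁, e₂, e₃, toWord_inv] using LT.t1 1 0 true true (by decide) c₁.toWord c₂.toWord c₃.toWord
  · simpa [e₁, e₂, e₃, toWord_inv] using LT.t2 1 0 true true (by decide) c₁.toWord c₂.toWord
  · simpa [e₁, e₂, e₃, toWord_inv] using LT.t2 0 1 true true (by decide) c₁.toWord c₂.toWord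

theorem LetterThin.of_equiv {x y z x' y' z' : W} (h : LetterThin x y z)
    (e : TripleEquiv (x', y', z') (x, y, z)) (hx : x' ∈ Alt) (hy : y' ∈ Alt) (hz : z' ∈ Alt) :
    LetterThin x' y' z' := by
  obtain ⟨-, -, -, y₁, y₂, y₃, he, hf⟩ := h
  exact ⟨hx, hy, hz, y₁, y₂, y₃, e.trans _ _ _ he, hf⟩

theorem mem_Alt {l : List Ltr} (h : AltL l) : FreeGroup.mk l ∈ Alt := by
  show List.IsChain _ _
  rw [toWord_mk_of_alt h]; exact h

def LTM (x y z : List Ltr) : Prop :=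
  AltL x → AltL y → AltL z → LetterThin (FreeGroup.mk x) (FreeGroup.mk y) (FreeGroup.mk z)

theorem alt_fa {l : List Ltr} (h : AltL l) : AltL (l.map fa) := alt_map fa (fun _ _ h => h) h
theorem alt_fb {l : List Ltr} (h : AltL l) : AltL (l.map fb) := alt_map fb (fun _ _ h => h) h

theorem LTM.of_fa {x y z : List Ltr} (h : LTM (x.map fa) (y.map fa) (z.map fa)) : LTM x y z := by
  intro hx hy hz
  refine LetterThin.of_equiv (h (alt_fa hx) (alt_fa hy) (alt_fa hz)) ?_
    (mem_Alt hx) (mem_Alt hy) (mem_Alt hz)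
  exact .rel _ _ (Or.inr (Or.inr (Or.inl (by simp [phia_mk]))))

theorem LTM.of_fb {x y z : List Ltr} (h : LTM (x.map fb) (y.map fb) (z.map fb)) : LTM x y z := by
  intro hx hy hz
  refine LetterThin.of_equiv (h (alt_fb hx) (alt_fb hy) (alt_fb hz)) ?_
    (mem_Alt hx) (mem_Alt hy) (mem_Alt hz)
  exact .rel _ _ (Or.inr (Or.inr (Or.inr (by simp [phib_mk]))))

theorem inv_map_fa (l : List Ltr) : (invRev l).map fa = invRev (l.map fa) := by
  induction l with
  | nil => simp
  | cons x l ih =>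
    obtain ⟨i, s⟩ := x
    fin_cases i <;> simp [inv_cons, ih, fa]

theorem inv_map_fb (l : List Ltr) : (invRev l).map fb = invRev (l.map fb) := by
  induction l with
  | nil => simp
  | cons x l ih =>
    obtain ⟨i, s⟩ := x
    fin_cases i <;> simp [inv_cons, ih, fb]

/-- Reduce a statement about all signs to positive signs. -/
theorem LTM_t1 (i j : Fin 2) (h : i ≠ j) (c₁ c₂ c₃ : List Ltr) :
    LTM (invRev c₁ ++ (i, true) :: (j, true) :: c₂) (invRev c₂ ++ (j, false) :: (i, true) :: c₃)
        (invRev c₃ ++ (i, false) :: c₁) := by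
  intro hx hy hz
  have h₁ : AltL c₁ := alt_tail (alt_suffix hz)
  have h₂ : AltL c₂ := alt_tail (alt_tail (alt_suffix hx))
  have h₃ : AltL c₃ := alt_tail (alt_tail (alt_suffix hy))
  refine ⟨mem_Alt hx, mem_Alt hy, mem_Alt hz, _, _, _, .refl _, ?_⟩
  have e : i = 0 ∧ j = 1 ∨ i = 1 ∧ j = 0 := by omega
  rcases e with ⟨rfl, rfl⟩ | ⟨rfl, rfl⟩
  · refine Or.inl ⟨FreeGroup.mk c₁, FreeGroup.mk c₂, FreeGroup.mk c₃,
      mem_Alt h₁, mem_Alt h₂, mem_Alt h₃, ?_⟩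
    simp only [toWord_inv, toWord_mk_of_alt h₁, toWord_mk_of_alt h₂, toWord_mk_of_alt h₃,
      toWord_mk_of_alt hx, toWord_mk_of_alt hy, toWord_mk_of_alt hz]
    simp
  · refine Or.inr (Or.inl ⟨FreeGroup.mk c₁, FreeGroup.mk c₂, FreeGroup.mk c₃,
      mem_Alt h₁, mem_Alt h₂, mem_Alt h₃, ?_⟩)
    simp only [toWord_inv, toWord_mk_of_alt h₁, toWord_mk_of_alt h₂, toWord_mk_of_alt h₃,
      toWord_mk_of_alt hx, toWord_mk_of_alt hy, toWord_mk_of_alt hz]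
    simp

theorem LTM_t2 (i j : Fin 2) (h : i ≠ j) (c₁ c₂ : List Ltr) :
    LTM (invRev c₁ ++ (i, false) :: (j, true) :: (i, true) :: c₂) (invRev c₂ ++ [(i, false)])
        ((i, true) :: c₁) := by
  intro hx hy hz
  have h₁ : AltL c₁ := alt_tail hz
  have h₂ : AltL c₂ := alt_tail (alt_tail (alt_tail (alt_suffix hx)))
  refine ⟨mem_Alt hx, mem_Alt hy, mem_Alt hz, _, _, _, .refl _, ?_⟩
  have e : i = 0 ∧ j = 1 ∨ i = 1 ∧ j = 0 := by omega
  rcases e with ⟨rfl, rfl⟩ | ⟨rfl, rfl⟩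
  · refine Or.inr (Or.inr (Or.inr ⟨FreeGroup.mk c₁, FreeGroup.mk c₂, mem_Alt h₁, mem_Alt h₂, ?_⟩))
    simp only [toWord_inv, toWord_mk_of_alt h₁, toWord_mk_of_alt h₂,
      toWord_mk_of_alt hx, toWord_mk_of_alt hy, toWord_mk_of_alt hz]
    simp
  · refine Or.inr (Or.inr (Or.inl ⟨FreeGroup.mk c₁, FreeGroup.mk c₂, mem_Alt h₁, mem_Alt h₂, ?_⟩))
    simp only [toWord_inv, toWord_mk_of_alt h₁, toWord_mk_of_alt h₂,
      toWord_mk_of_alt hx, toWord_mk_of_alt hy, toWord_mk_of_alt hz]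
    simp

/-- Flip the sign of the letter with index `i`. -/
theorem LTM.of_flip (i : Fin 2) {x y z : List Ltr}
    (h : LTM (x.map (fun p => (p.1, if p.1 = i then !p.2 else p.2)))
      (y.map (fun p => (p.1, if p.1 = i then !p.2 else p.2)))
      (z.map (fun p => (p.1, if p.1 = i then !p.2 else p.2)))) : LTM x y z := by
  have e : i = 0 ∨ i = 1 := by omega
  rcases e with rfl | rfl
  · exact LTM.of_fa h
  · have : (fun p : Ltr => (p.1, if p.1 = 1 then !p.2 else p.2)) = fb := by
      funext ⟨i, s⟩
      fin_cases i <;> simp [fb]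
    rw [this] at h
    exact LTM.of_fb h

theorem inv_map_flip (i : Fin 2) (l : List Ltr) :
    (invRev l).map (fun p => (p.1, if p.1 = i then !p.2 else p.2)) =
      invRev (l.map (fun p => (p.1, if p.1 = i then !p.2 else p.2))) := by
  induction l with
  | nil => simp
  | cons x l ih =>
    obtain ⟨j, s⟩ := x
    by_cases h : j = i <;> simp [inv_cons, ih, h]

theorem letterThin_of_LT {x y z : List Ltr} (h : LT x y z) : LTM x y z := by
  induction h with
  | t1 i j s t h c₁ c₂ c₃ =>
    have h' : ¬ j = i := fun e => h e.symm
    have aux : ∀ s c₁ c₂ c₃, LTM (invRev c₁ ++ (i, s) :: (j, true) :: c₂)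
        (invRev c₂ ++ (j, false) :: (i, s) :: c₃) (invRev c₃ ++ (i, !s) :: c₁) := by
      intro s c₁ c₂ c₃
      cases s with
      | true => exact LTM_t1 i j h _ _ _
      | false =>
        apply LTM.of_flip i
        simp only [List.map_append, inv_map_flip, List.map_cons, h', if_true, if_false]
        exact LTM_t1 i j h _ _ _
    cases t with
    | true => exact aux _ _ _ _
    | false =>
      apply LTM.of_flip j
      simp only [List.map_append, inv_map_flip, List.map_cons, h, if_true, if_false]
      exact aux _ _ _ _
  | t2 i j s t h c₁ c₂ =>
    have h' : ¬ j = i := fun e => h e.symm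
    have aux : ∀ s c₁ c₂, LTM (invRev c₁ ++ (i, !s) :: (j, true) :: (i, s) :: c₂)
        (invRev c₂ ++ [(i, !s)]) ((i, s) :: c₁) := by
      intro s c₁ c₂
      cases s with
      | true => exact LTM_t2 i j h _ _
      | false =>
        apply LTM.of_flip i
        simp only [List.map_append, inv_map_flip, List.map_cons, h', if_true, if_false]
        exact LTM_t2 i j h _ _
    cases t with
    | true => exact aux _ _ _
    | false =>
      apply LTM.of_flip j
      simp only [List.map_append, inv_map_flip, List.map_cons, h, if_true, if_false]
      exact aux _ _ _
  | rot x y z h ih =>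
    intro hy hz hx
    exact LetterThin.of_equiv (ih hx hy hz) (.symm _ _ (.rel _ _ (Or.inl rfl)))
      (mem_Alt hy) (mem_Alt hz) (mem_Alt hx)
  | inv x y z h ih =>
    intro hz hy hx
    have hz' := alt_inv hz
    have hy' := alt_inv hy
    have hx' := alt_inv hx
    rw [invRev_invRev] at hx' hy' hz'
    refine LetterThin.of_equiv (ih hx' hy' hz') (.symm _ _ (.rel _ _ (Or.inr (Or.inl ?_))))
      (mem_Alt hz) (mem_Alt hy) (mem_Alt hx)
    simp [inv_mk]

end LThin

/-- **Lemma.** The maps `α` and `β` send letter-thin triples to letter-thin triples. -/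
theorem alphaF_betaF_letterThin (x₁ x₂ x₃ : W) (h : LetterThin x₁ x₂ x₃) :
    LetterThin (alphaF x₁) (alphaF x₂) (alphaF x₃) ∧
    LetterThin (betaF x₁) (betaF x₂) (betaF x₃) := by
  have hL := LThin.LT_of_letterThin h
  obtain ⟨h₁, h₂, h₃, -⟩ := h
  exact ⟨LThin.letterThin_of_LT (hL.goA h₁ h₂ h₃)
      (LThin.alt_goA _ h₁) (LThin.alt_goA _ h₂) (LThin.alt_goA _ h₃),
    LThin.letterThin_of_LT (hL.goB h₁ h₂ h₃)
      (LThin.alt_goB _ h₁) (LThin.alt_goB _ h₂) (LThin.alt_goB _ h₃)⟩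
end

section
/- Let A, B, C be groups, κ_A : C → A and κ_B : C → B injective homomorphisms, and suppose G-invariant linear orders are given on A/κ_A(C) and B/κ_B(C) with associated sign functions sign_A and sign_B. Then the map Φ : A ★_C B → 𝒜, defined by Φ(g) = e for g in the image of C and otherwise Φ(g) = x₁⋯x_k where g = d₁⋯d_k is a normal form with d_i alternately in A∖κ_A(C) and B∖κ_B(C), x_i = a^{sign_A(d_i)} if d_i ∈ A∖κ_A(C) and x_i = b^{sign_B(d_i)} if d_i ∈ B∖κ_B(C), is well defined (independent of the chosen normal form) and is a letter-quasimorphism. -/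
open Monoid FreeGroup

/-- A letter-quasimorphism `Φ : G → 𝒜`. -/
def IsLetterQM {G : Type*} [Group G] (Φ : G → W) : Prop :=
  (∀ g, Φ g ∈ Alt) ∧
  (∀ g : G, Φ g⁻¹ = (Φ g)⁻¹) ∧
  (∀ g h : G,
    Φ g * Φ h * (Φ (g * h))⁻¹ = 1 ∨
    ∃ (i : Fin 2) (s₁ s₂ s₃ : Bool) (c₁ c₂ c₃ : W),
      c₁ ∈ Alt ∧ c₂ ∈ Alt ∧ c₃ ∈ Alt ∧
      ¬(s₁ = s₂ ∧ s₂ = s₃) ∧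
      (Φ g).toWord = (c₁⁻¹).toWord ++ [(i, s₁)] ++ c₂.toWord ∧
      (Φ h).toWord = (c₂⁻¹).toWord ++ [(i, s₂)] ++ c₃.toWord ∧
      ((Φ (g * h))⁻¹).toWord = (c₃⁻¹).toWord ++ [(i, s₃)] ++ c₁.toWord)

variable {A B C : Type*} [Group A] [Group B] [Group C]

/-- The relations of the amalgamated free product `A ★_C B`. -/
def amalRels (κA : C →* A) (κB : C →* B) : Subgroup (Coprod A B) :=
  Subgroup.normalClosure {x | ∃ c : C, x = (Coprod.inl (κA c))⁻¹ * Coprod.inr (κB c)}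

instance (κA : C →* A) (κB : C →* B) : (amalRels κA κB).Normal :=
  Subgroup.normalClosure_normal

/-- The amalgamated free product `A ★_C B`. -/
def Amal (κA : C →* A) (κB : C →* B) : Type _ :=
  Coprod A B ⧸ amalRels κA κB

instance (κA : C →* A) (κB : C →* B) : Group (Amal κA κB) :=
  QuotientGroup.Quotient.group _

/-- The canonical homomorphism `A →* A ★_C B`. -/
def amalInl (κA : C →* A) (κB : C →* B) : A →* Amal κA κB :=
  (QuotientGroup.mk' (amalRels κA κB)).comp Coprod.inl

/-- The canonical homomorphism `B →* A ★_C B`. -/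
def amalInr (κA : C →* A) (κB : C →* B) : B →* Amal κA κB :=
  (QuotientGroup.mk' (amalRels κA κB)).comp Coprod.inr

/-- The (Boolean) sign of `g` with respect to an order `r` on the coset space
`G ⧸ H`: `true` iff `H ≺ gH`. On elements `g ∉ H` this corresponds to
`sign(g) = +1` (versus `sign(g) = -1`). -/
noncomputable def signPos {G : Type*} [Group G] (H : Subgroup G)
    (r : G ⧸ H → G ⧸ H → Prop) (g : G) : Bool :=
  letI := Classical.dec (r (QuotientGroup.mk (1 : G)) (QuotientGroup.mk g))
  if r (QuotientGroup.mk (1 : G)) (QuotientGroup.mk g) then true else false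

/-- A normal-form list for the amalgamated product: entries alternate between
factors and avoid the amalgamated subgroup. -/
def IsNormalForm (κA : C →* A) (κB : C →* B) (l : List (A ⊕ B)) : Prop :=
  List.Chain' (fun d d' => d.isLeft ≠ d'.isLeft) l ∧
  (∀ d ∈ l, (∀ a : A, d = Sum.inl a → a ∉ κA.range) ∧
    (∀ b : B, d = Sum.inr b → b ∉ κB.range))

/-- The element of `A ★_C B` represented by a normal-form list. -/
def prodOf (κA : C →* A) (κB : C →* B) (l : List (A ⊕ B)) : Amal κA κB :=
  (l.map (Sum.elim (amalInl κA κB) (amalInr κA κB))).prod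

/-- The alternating word of signs `x₁ ⋯ x_k` attached to a normal-form list,
using the sign functions of the orders `rA` and `rB`. -/
noncomputable def wordOf (κA : C →* A) (κB : C →* B)
    (rA : A ⧸ κA.range → A ⧸ κA.range → Prop)
    (rB : B ⧸ κB.range → B ⧸ κB.range → Prop) (l : List (A ⊕ B)) : W :=
  FreeGroup.mk (l.map fun d => match d with
    | Sum.inl a => ((0 : Fin 2), signPos κA.range rA a)
    | Sum.inr b => ((1 : Fin 2), signPos κB.range rB b))


section SignLemmas

variable {G : Type*} [Group G] (H : Subgroup G) (r : G ⧸ H → G ⧸ H → Prop)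

theorem signPos_eq_true {g : G} :
    signPos H r g = true ↔ r (QuotientGroup.mk (1 : G)) (QuotientGroup.mk g) := by
  unfold signPos
  simp

variable (hlin : IsLinearOrder _ r)
  (hinv : ∀ (a : G) (x y : G ⧸ H), r x y → r (a • x) (a • y))

include hinv in
theorem signPos_mul_left {h : G} (hh : h ∈ H) (g : G) :
    signPos H r (h * g) = signPos H r g := by
  have e1 : (QuotientGroup.mk h : G ⧸ H) = QuotientGroup.mk 1 := by
    rw [QuotientGroup.eq]; simpa using hh
  rw [Bool.eq_iff_iff, signPos_eq_true, signPos_eq_true]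
  constructor
  · intro h1
    have := hinv h⁻¹ _ _ (e1 ▸ h1)
    rw [MulAction.Quotient.smul_mk, MulAction.Quotient.smul_mk] at this
    simpa using this
  · intro h1
    have := hinv h _ _ h1
    rw [MulAction.Quotient.smul_mk, MulAction.Quotient.smul_mk] at this
    simpa [e1] using this

theorem signPos_mul_right {h : G} (hh : h ∈ H) (g : G) :
    signPos H r (g * h) = signPos H r g := by
  have e1 : (QuotientGroup.mk (g * h) : G ⧸ H) = QuotientGroup.mk g := by
    rw [QuotientGroup.eq]; simpa using hh
  rw [Bool.eq_iff_iff, signPos_eq_true, signPos_eq_true, e1]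

include hlin hinv in
theorem signPos_inv {g : G} (hg : g ∉ H) : signPos H r g⁻¹ = !signPos H r g := by
  have key : r (QuotientGroup.mk (1 : G)) (QuotientGroup.mk g⁻¹) ↔
      r (QuotientGroup.mk g) (QuotientGroup.mk (1 : G)) := by
    constructor
    · intro h1
      have := hinv g _ _ h1
      rw [MulAction.Quotient.smul_mk, MulAction.Quotient.smul_mk] at this
      simpa using this
    · intro h1
      have := hinv g⁻¹ _ _ h1
      rw [MulAction.Quotient.smul_mk, MulAction.Quotient.smul_mk] at this
      simpa using this
  rw [Bool.eq_iff_iff, signPos_eq_true, key, Bool.not_eq_true', ← Bool.not_eq_true,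
    signPos_eq_true]
  constructor
  · intro h1 h2
    have := hlin.antisymm _ _ h1 h2
    rw [QuotientGroup.eq] at this
    exact hg (by simpa using this)
  · intro h1
    exact (hlin.total _ _).resolve_right h1

include hlin hinv in
theorem signPos_mul_true {g h : G} (hg : signPos H r g = true) (hh : signPos H r h = true) :
    signPos H r (g * h) = true := by
  rw [signPos_eq_true] at *
  have := hinv g _ _ hh
  rw [MulAction.Quotient.smul_mk, MulAction.Quotient.smul_mk] at this
  exact hlin.trans _ _ _ hg (by simpa using this)

include hlin hinv in
theorem signPos_mul_false {g h : G} (hgh : g * h ∉ H)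
    (hg : g ∉ H) (hh : h ∉ H)
    (hg' : signPos H r g = false) (hh' : signPos H r h = false) :
    signPos H r (g * h) = false := by
  have h1 := signPos_inv H r hlin hinv hg
  have h2 := signPos_inv H r hlin hinv hh
  have h3 := signPos_inv H r hlin hinv hgh
  rw [mul_inv_rev, signPos_mul_true H r hlin hinv (by simp [h2, hh']) (by simp [h1, hg'])] at h3
  simpa using h3.symm

include hlin hinv in
/-- The sign computation for `e = d⁻¹ c d'` in a single factor. -/
theorem signPos_triple {d d' c : G} (hc : c ∈ H) (hd : d ∉ H) (hd' : d' ∉ H)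
    (he : d⁻¹ * c * d' ∉ H) :
    ¬((!signPos H r d) = signPos H r d' ∧
      signPos H r d' = !signPos H r (d⁻¹ * c * d')) := by
  have e : d * (d⁻¹ * c * d') = c * d' := by group
  have hcd : signPos H r (d * (d⁻¹ * c * d')) = signPos H r d' := by
    rw [e, signPos_mul_left H r hinv hc]
  have hn : d * (d⁻¹ * c * d') ∉ H := by
    rw [e, Subgroup.mul_mem_cancel_left H hc]; exact hd'
  rintro ⟨h1, h2⟩
  cases h3 : signPos H r d
  · have := signPos_mul_false H r hlin hinv hn hd he h3 (by rw [← h1, h3] at h2; simpa using h2)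
    rw [hcd, ← h1, h3] at this
    simp at this
  · have := signPos_mul_true H r hlin hinv h3 (by rw [← h1, h3] at h2; simpa using h2)
    rw [hcd, ← h1, h3] at this
    simp at this

include hinv in
theorem signPos_eq_of_mem {d d' c : G} (hc : c ∈ H) (he : d⁻¹ * c * d' ∈ H) :
    signPos H r d = signPos H r d' := by
  rw [← signPos_mul_left H r hinv hc d', ← signPos_mul_right H r he d]
  congr 1
  group

end SignLemmas

section NormalFormTheorem

universe u v w

/-- The two factors as a family over `Bool`, in a common universe. -/
def Fam (A : Type u) (B : Type v) : Bool → Type (max u v)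
  | true => ULift.{v} A
  | false => ULift.{u} B

instance famGroup (A : Type u) (B : Type v) [Group A] [Group B] : ∀ i, Group (Fam A B i)
  | true => inferInstanceAs (Group (ULift.{v} A))
  | false => inferInstanceAs (Group (ULift.{u} B))

variable {A : Type u} {B : Type v} {C : Type w} [Group A] [Group B] [Group C]

/-- Inclusion of `A` in the family. -/
def famA (A : Type u) (B : Type v) [Group A] [Group B] : A →* Fam A B true :=
  (MulEquiv.ulift (α := A)).symm.toMonoidHom

/-- Inclusion of `B` in the family. -/
def famB (A : Type u) (B : Type v) [Group A] [Group B] : B →* Fam A B false :=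
  (MulEquiv.ulift (α := B)).symm.toMonoidHom

theorem famA_inj : Function.Injective (famA A B) := (MulEquiv.ulift (α := A)).symm.injective
theorem famB_inj : Function.Injective (famB A B) := (MulEquiv.ulift (α := B)).symm.injective

/-- The diagram of the pushout. -/
def famMap (κA : C →* A) (κB : C →* B) : ∀ i, C →* Fam A B i
  | true => (famA A B).comp κA
  | false => (famB A B).comp κB

/-- Comparison with Mathlib's pushout. -/
def toPush (κA : C →* A) (κB : C →* B) : Amal κA κB →* PushoutI (famMap κA κB) :=
  QuotientGroup.lift (amalRels κA κB)
    (Coprod.lift ((PushoutI.of (φ := famMap κA κB) true).comp (famA A B))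
      ((PushoutI.of (φ := famMap κA κB) false).comp (famB A B))) (by
    intro x hx
    refine (Subgroup.normalClosure_le_normal ?_ : amalRels κA κB ≤ _) hx
    rintro _ ⟨c, rfl⟩
    rw [SetLike.mem_coe, MonoidHom.mem_ker, _root_.map_mul, _root_.map_inv, Coprod.lift_apply_inl,
      Coprod.lift_apply_inr]
    have h1 := PushoutI.of_apply_eq_base (famMap κA κB) true c
    have h2 := PushoutI.of_apply_eq_base (famMap κA κB) false c
    rw [inv_mul_eq_one]
    exact h1.trans h2.symm)

theorem toPush_inl (κA : C →* A) (κB : C →* B) (a : A) :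
    toPush κA κB (amalInl κA κB a) = PushoutI.of (φ := famMap κA κB) true (famA A B a) := by
  exact Coprod.lift_apply_inl ((PushoutI.of (φ := famMap κA κB) true).comp (famA A B))
    ((PushoutI.of (φ := famMap κA κB) false).comp (famB A B)) a

theorem toPush_inr (κA : C →* A) (κB : C →* B) (b : B) :
    toPush κA κB (amalInr κA κB b) = PushoutI.of (φ := famMap κA κB) false (famB A B b) := by
  exact Coprod.lift_apply_inr ((PushoutI.of (φ := famMap κA κB) true).comp (famA A B))
    ((PushoutI.of (φ := famMap κA κB) false).comp (famB A B)) b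

/-- Letters as elements of the sigma type. -/
def sig : A ⊕ B → Σ i, Fam A B i
  | Sum.inl a => ⟨true, famA A B a⟩
  | Sum.inr b => ⟨false, famB A B b⟩

theorem sig_fst (d : A ⊕ B) : (sig d).1 = d.isLeft := by cases d <;> rfl

theorem sig_not_mem (κA : C →* A) (κB : C →* B) (d : A ⊕ B)
    (h : (∀ a : A, d = Sum.inl a → a ∉ κA.range) ∧ (∀ b : B, d = Sum.inr b → b ∉ κB.range)) :
    (sig d).2 ∉ (famMap κA κB (sig d).1).range := by
  rcases d with a | b
  · rintro ⟨c, hc⟩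
    exact h.1 a rfl ⟨c, famA_inj (B := B) hc⟩
  · rintro ⟨c, hc⟩
    exact h.2 b rfl ⟨c, famB_inj (A := A) hc⟩

theorem normalForm_eq_nil (κA : C →* A) (κB : C →* B)
    (hA : Function.Injective κA) (hB : Function.Injective κB) (l : List (A ⊕ B))
    (hl : IsNormalForm κA κB l) (c : C) (h : prodOf κA κB l = amalInl κA κB (κA c)) :
    l = [] := by
  let w : CoprodI.Word (Fam A B) :=
    { toList := l.map sig
      ne_one := by
        intro x hx h1
        obtain ⟨d, hd, rfl⟩ := List.mem_map.1 hx
        refine sig_not_mem κA κB d (hl.2 d hd) ?_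
        rw [h1]; exact one_mem _
      chain_ne := by
        rw [List.isChain_map]
        have := hl.1
        simp only [sig_fst]
        exact this }
  have hw : PushoutI.Reduced (famMap κA κB) w := by
    intro x hx
    obtain ⟨d, hd, rfl⟩ := List.mem_map.1 hx
    exact sig_not_mem κA κB d (hl.2 d hd)
  have hinj : ∀ i, Function.Injective (famMap κA κB i) := by
    rintro (_ | _)
    · exact famB_inj.comp hB
    · exact famA_inj.comp hA
  have hp : PushoutI.ofCoprodI w.prod = toPush κA κB (prodOf κA κB l) := by
    simp only [w, CoprodI.Word.prod, prodOf, map_list_prod, List.map_map]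
    congr 1
    apply List.map_congr_left
    rintro (a | b) _
    · exact (toPush_inl κA κB a).symm
    · exact (toPush_inr κA κB b).symm
  have := hw.eq_empty_of_mem_range hinj (by
    rw [hp, h, toPush_inl]
    exact ⟨c, (PushoutI.of_apply_eq_base (famMap κA κB) true c).symm⟩)
  have h2 : l.map sig = [] := congrArg CoprodI.Word.toList this
  simpa using h2

end NormalFormTheorem

section Words

/-- Alternating lists of letters. -/
def AltL (x : List (Fin 2 × Bool)) : Prop := List.IsChain (· ≠ ·) (x.map Prod.fst)

theorem AltL.isReduced {x : List (Fin 2 × Bool)} (h : AltL x) : FreeGroup.IsReduced x := by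
  unfold AltL at h
  rw [List.isChain_map] at h
  exact h.imp (fun p q hpq hpq' => absurd hpq' hpq)

theorem AltL.toWord {x : List (Fin 2 × Bool)} (h : AltL x) : (FreeGroup.mk x).toWord = x := by
  rw [FreeGroup.toWord_mk, h.isReduced.reduce_eq]

theorem AltL.mem {x : List (Fin 2 × Bool)} (h : AltL x) : FreeGroup.mk x ∈ Alt := by
  change List.IsChain _ (FreeGroup.mk x).toWord
  rw [h.toWord]
  unfold AltL at h
  rwa [List.isChain_map] at h

theorem AltL.invRev {x : List (Fin 2 × Bool)} (h : AltL x) : AltL (FreeGroup.invRev x) := by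
  unfold AltL at *
  have : (FreeGroup.invRev x).map Prod.fst = (x.map Prod.fst).reverse := by
    simp [FreeGroup.invRev, Function.comp_def]
  rw [this, List.isChain_reverse]
  exact h.imp (fun _ _ h => h.symm)

theorem AltL.left {x y : List (Fin 2 × Bool)} (h : AltL (x ++ y)) : AltL x := by
  unfold AltL at *
  rw [List.map_append] at h
  exact h.left_of_append

theorem AltL.right {x y : List (Fin 2 × Bool)} (h : AltL (x ++ y)) : AltL y := by
  unfold AltL at *
  rw [List.map_append] at h
  exact h.right_of_append

theorem AltL.tail {a} {y : List (Fin 2 × Bool)} (h : AltL (a :: y)) : AltL y :=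
  AltL.right (x := [a]) h

/-- The relation between words `x` of `g`, `y` of `h` and `w` of `g⁻¹h`. -/
def Tri (x y w : List (Fin 2 × Bool)) : Prop :=
  (FreeGroup.mk x)⁻¹ * FreeGroup.mk y = FreeGroup.mk w ∨
  ∃ (p t t' : List (Fin 2 × Bool)) (i : Fin 2) (s s' s'' : Bool),
    x = p ++ (i, s) :: t ∧ y = p ++ (i, s') :: t' ∧
    w = FreeGroup.invRev t ++ (i, s'') :: t' ∧ ¬((!s) = s' ∧ s' = !s'')

theorem Tri.cons {x y w : List (Fin 2 × Bool)} (h : Tri x y w) (a : Fin 2 × Bool) :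
    Tri (a :: x) (a :: y) w := by
  rcases h with h | ⟨p, t, t', i, s, s', s'', rfl, rfl, rfl, h⟩
  · left
    rw [← h]
    have e : ∀ z : List (Fin 2 × Bool), FreeGroup.mk (a :: z) = FreeGroup.mk [a] * FreeGroup.mk z :=
      fun z => by simp
    rw [e x, e y]
    group
  · exact Or.inr ⟨a :: p, t, t', i, s, s', s'', rfl, rfl, rfl, h⟩

end Words

section Main

variable (κA : C →* A) (κB : C →* B)

/-- A letter outside the amalgamated subgroup. -/
def Good (d : A ⊕ B) : Prop :=
  (∀ a : A, d = Sum.inl a → a ∉ κA.range) ∧ (∀ b : B, d = Sum.inr b → b ∉ κB.range)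

theorem good_inl (a : A) : Good κA κB (Sum.inl a) ↔ a ∉ κA.range := by simp [Good]

theorem good_inr (b : B) : Good κA κB (Sum.inr b) ↔ b ∉ κB.range := by simp [Good]

theorem isNormalForm_iff (l : List (A ⊕ B)) : IsNormalForm κA κB l ↔
    List.IsChain (· ≠ ·) (l.map Sum.isLeft) ∧ ∀ d ∈ l, Good κA κB d := by
  rw [List.isChain_map]; rfl

/-- Evaluation of a letter. -/
def ev (d : A ⊕ B) : Amal κA κB := Sum.elim (amalInl κA κB) (amalInr κA κB) d

/-- The image of the amalgamated subgroup. -/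
def zc (c : C) : Amal κA κB := amalInl κA κB (κA c)

theorem zc_mul (c c' : C) : zc κA κB (c * c') = zc κA κB c * zc κA κB c' := by simp [zc]
theorem zc_inv (c : C) : zc κA κB c⁻¹ = (zc κA κB c)⁻¹ := by simp [zc]
theorem zc_one : zc κA κB 1 = 1 := by simp [zc]

theorem amalInr_eq (c : C) : amalInr κA κB (κB c) = zc κA κB c := by
  symm
  refine QuotientGroup.eq.2 ?_
  exact Subgroup.subset_normalClosure ⟨c, rfl⟩

theorem prodOf_nil : prodOf κA κB [] = 1 := rfl

theorem prodOf_cons (d : A ⊕ B) (l : List (A ⊕ B)) :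
    prodOf κA κB (d :: l) = ev κA κB d * prodOf κA κB l := by
  simp [prodOf, ev]

theorem prodOf_append (l m : List (A ⊕ B)) :
    prodOf κA κB (l ++ m) = prodOf κA κB l * prodOf κA κB m := by
  simp [prodOf]

/-- Inverse of a letter. -/
def linv (d : A ⊕ B) : A ⊕ B := Sum.map (·⁻¹) (·⁻¹) d

/-- Left multiplication of a letter by an element of `C`. -/
def lact (c : C) (d : A ⊕ B) : A ⊕ B := Sum.map (κA c * ·) (κB c * ·) d

/-- Inverse of a list. -/
def Linv (l : List (A ⊕ B)) : List (A ⊕ B) := (l.map linv).reverse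

theorem linv_isLeft (d : A ⊕ B) : (linv d).isLeft = d.isLeft := by cases d <;> rfl
theorem lact_isLeft (c : C) (d : A ⊕ B) : (lact κA κB c d).isLeft = d.isLeft := by cases d <;> rfl

theorem ev_linv (d : A ⊕ B) : ev κA κB (linv d) = (ev κA κB d)⁻¹ := by
  cases d <;> simp [ev, linv]

theorem ev_lact (c : C) (d : A ⊕ B) : ev κA κB (lact κA κB c d) = zc κA κB c * ev κA κB d := by
  cases d
  · simp [ev, lact, zc]
  · simp [ev, lact, ← amalInr_eq]

theorem prodOf_Linv (l : List (A ⊕ B)) : prodOf κA κB (Linv l) = (prodOf κA κB l)⁻¹ := by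
  induction l with
  | nil => simp [Linv, prodOf_nil]
  | cons d l ih =>
    have : Linv (d :: l) = Linv l ++ [linv d] := by simp [Linv]
    rw [this, prodOf_append, ih, prodOf_cons, prodOf_cons, prodOf_nil, ev_linv]
    simp

theorem good_linv {d : A ⊕ B} (h : Good κA κB d) : Good κA κB (linv d) := by
  cases d
  · simp only [linv, Sum.map_inl, good_inl] at *
    simpa using h
  · simp only [linv, Sum.map_inr, good_inr] at *
    simpa using h

theorem good_lact (c : C) {d : A ⊕ B} (h : Good κA κB d) : Good κA κB (lact κA κB c d) := by
  cases d
  · simp only [lact, Sum.map_inl, good_inl] at *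
    rwa [Subgroup.mul_mem_cancel_left _ (MonoidHom.mem_range.2 ⟨c, rfl⟩)]
  · simp only [lact, Sum.map_inr, good_inr] at *
    rwa [Subgroup.mul_mem_cancel_left _ (MonoidHom.mem_range.2 ⟨c, rfl⟩)]

theorem Linv_isLeft (l : List (A ⊕ B)) : (Linv l).map Sum.isLeft = (l.map Sum.isLeft).reverse := by
  simp [Linv, linv_isLeft, Function.comp_def]

theorem mem_Linv_good {l : List (A ⊕ B)} (h : ∀ d ∈ l, Good κA κB d) :
    ∀ d ∈ Linv l, Good κA κB d := by
  intro d hd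
  simp only [Linv, List.mem_reverse, List.mem_map] at hd
  obtain ⟨e, he, rfl⟩ := hd
  exact good_linv κA κB (h e he)

theorem normal_Linv {l : List (A ⊕ B)} (h : IsNormalForm κA κB l) :
    IsNormalForm κA κB (Linv l) := by
  rw [isNormalForm_iff] at *
  refine ⟨?_, mem_Linv_good κA κB h.2⟩
  rw [Linv_isLeft, List.isChain_reverse]
  exact h.1.imp (fun _ _ h => h.symm)

theorem normal_tail {d : A ⊕ B} {l : List (A ⊕ B)} (h : IsNormalForm κA κB (d :: l)) :
    IsNormalForm κA κB l := by
  rw [isNormalForm_iff] at *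
  exact ⟨h.1.tail, fun e he => h.2 e (List.mem_cons_of_mem _ he)⟩

theorem good_head {d : A ⊕ B} {l : List (A ⊕ B)} (h : IsNormalForm κA κB (d :: l)) :
    Good κA κB d := by
  rw [isNormalForm_iff] at h
  exact h.2 d List.mem_cons_self

theorem normal_nil : IsNormalForm κA κB [] := by
  rw [isNormalForm_iff]; simp

theorem normal_replace {d e : A ⊕ B} {l : List (A ⊕ B)} (h : IsNormalForm κA κB (d :: l))
    (he : Good κA κB e) (hde : e.isLeft = d.isLeft) : IsNormalForm κA κB (e :: l) := by
  rw [isNormalForm_iff] at *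
  refine ⟨by simpa [hde] using h.1, ?_⟩
  intro f hf
  rcases List.mem_cons.1 hf with rfl | hf
  · exact he
  · exact h.2 f (List.mem_cons_of_mem _ hf)

/-- Joining `t⁻¹` and `e :: t'` where `e` is on the same side as the letters removed. -/
theorem normal_join {e : A ⊕ B} {t t' : List (A ⊕ B)} (h : IsNormalForm κA κB (e :: t))
    (h' : IsNormalForm κA κB (e :: t')) : IsNormalForm κA κB (Linv t ++ e :: t') := by
  have h1 := normal_Linv κA κB h
  have : Linv (e :: t) = Linv t ++ [linv e] := by simp [Linv]
  rw [this] at h1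
  rw [isNormalForm_iff] at *
  constructor
  · have := h1.1
    have h2 := h'.1
    simp only [List.map_append, List.map_cons, List.map_nil, linv_isLeft] at this h2 ⊢
    rw [List.isChain_split]
    exact ⟨this, h2⟩
  · intro f hf
    rcases List.mem_append.1 hf with hf | hf
    · exact h1.2 f (List.mem_append_left _ hf)
    · exact h'.2 f hf

theorem normal_join' {d d' : A ⊕ B} {t t' : List (A ⊕ B)} (h : IsNormalForm κA κB (d :: t))
    (h' : IsNormalForm κA κB (d' :: t')) (hd : d.isLeft ≠ d'.isLeft) :
    IsNormalForm κA κB (Linv (d :: t) ++ d' :: t') := by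
  refine normal_join κA κB (e := d') (t := d :: t) ?_ h'
  rw [isNormalForm_iff] at *
  refine ⟨?_, ?_⟩
  · simp only [List.map_cons, List.isChain_cons_cons] at *
    exact ⟨hd.symm, h.1⟩
  · intro f hf
    rcases List.mem_cons.1 hf with rfl | hf
    · exact h'.2 _ List.mem_cons_self
    · exact h.2 f hf

variable (rA : A ⧸ κA.range → A ⧸ κA.range → Prop)
    (rB : B ⧸ κB.range → B ⧸ κB.range → Prop)

/-- The signed letter of a factor element. -/
noncomputable def letter (d : A ⊕ B) : Fin 2 × Bool :=
  match d with
    | Sum.inl a => ((0 : Fin 2), signPos κA.range rA a)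
    | Sum.inr b => ((1 : Fin 2), signPos κB.range rB b)

theorem wordOf_eq (l : List (A ⊕ B)) :
    wordOf κA κB rA rB l = FreeGroup.mk (l.map (letter κA κB rA rB)) := rfl

theorem altL_letters {l : List (A ⊕ B)} (h : IsNormalForm κA κB l) :
    AltL (l.map (letter κA κB rA rB)) := by
  rw [isNormalForm_iff, List.isChain_map] at h
  unfold AltL
  rw [List.map_map, List.isChain_map]
  refine h.1.imp ?_
  rintro (a | b) (a' | b') hab
  · simp at hab
  · simp [letter]
  · simp [letter]
  · simp at hab

/-- `WRep g x`: the word `x` is the sign word of a normal form of `g` (up to `C`). -/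
def WRep (g : Amal κA κB) (x : List (Fin 2 × Bool)) : Prop :=
  ∃ (c : C) (l : List (A ⊕ B)), IsNormalForm κA κB l ∧ g = zc κA κB c * prodOf κA κB l ∧
    x = l.map (letter κA κB rA rB)

theorem WRep.altL {g : Amal κA κB} {x} (h : WRep κA κB rA rB g x) : AltL x := by
  obtain ⟨c, l, hl, -, rfl⟩ := h
  exact altL_letters κA κB rA rB hl

variable
    (hlinA : IsLinearOrder _ rA) (hlinB : IsLinearOrder _ rB)
    (hinvA : ∀ (a : A) (x y : A ⧸ κA.range), rA x y → rA (a • x) (a • y))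
    (hinvB : ∀ (b : B) (x y : B ⧸ κB.range), rB x y → rB (b • x) (b • y))

include hinvA hinvB in
theorem letter_lact (c : C) (d : A ⊕ B) :
    letter κA κB rA rB (lact κA κB c d) = letter κA κB rA rB d := by
  rcases d with a | b
  · simp [letter, lact, signPos_mul_left κA.range rA hinvA (h := κA c) ⟨c, rfl⟩]
  · simp [letter, lact, signPos_mul_left κB.range rB hinvB (h := κB c) ⟨c, rfl⟩]

include hlinA hlinB hinvA hinvB in
theorem letter_linv {d : A ⊕ B} (hd : Good κA κB d) :
    letter κA κB rA rB (linv d) =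
      ((letter κA κB rA rB d).1, !(letter κA κB rA rB d).2) := by
  rcases d with a | b
  · rw [good_inl] at hd
    simp [letter, linv, signPos_inv κA.range rA hlinA hinvA hd]
  · rw [good_inr] at hd
    simp [letter, linv, signPos_inv κB.range rB hlinB hinvB hd]

include hlinA hlinB hinvA hinvB in
theorem letters_Linv {l : List (A ⊕ B)} (hl : ∀ d ∈ l, Good κA κB d) :
    (Linv l).map (letter κA κB rA rB) =
      FreeGroup.invRev (l.map (letter κA κB rA rB)) := by
  unfold Linv FreeGroup.invRev
  rw [List.map_reverse, List.map_map, List.map_map]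
  congr 1
  apply List.map_congr_left
  intro d hd
  exact letter_linv κA κB rA rB hlinA hlinB hinvA hinvB (hl d hd)

include hlinA hlinB hinvA hinvB in
/-- The dichotomy for two letters on the same side. -/
theorem same_side {d d' : A ⊕ B} (c : C) (hd : Good κA κB d) (hd' : Good κA κB d')
    (h : d.isLeft = d'.isLeft) :
    (∃ c', (ev κA κB d)⁻¹ * zc κA κB c * ev κA κB d' = zc κA κB c' ∧
      letter κA κB rA rB d = letter κA κB rA rB d') ∨
    (∃ e i s s' s'', Good κA κB e ∧ e.isLeft = d.isLeft ∧
      (ev κA κB d)⁻¹ * zc κA κB c * ev κA κB d' = ev κA κB e ∧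
      letter κA κB rA rB d = (i, s) ∧ letter κA κB rA rB d' = (i, s') ∧
      letter κA κB rA rB e = (i, s'') ∧ ¬((!s) = s' ∧ s' = !s'')) := by
  rcases d with a | b <;> rcases d' with a' | b' <;> simp only [Sum.isLeft_inl, Sum.isLeft_inr,
    Bool.true_eq_false, Bool.false_eq_true] at h
  · rw [good_inl] at hd hd'
    have e : (ev κA κB (Sum.inl a))⁻¹ * zc κA κB c * ev κA κB (Sum.inl a') =
        amalInl κA κB (a⁻¹ * κA c * a') := by simp [ev, zc]
    rw [e]
    by_cases hm : a⁻¹ * κA c * a' ∈ κA.range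
    · left
      obtain ⟨c', hc'⟩ := id hm
      refine ⟨c', by rw [← hc']; rfl, ?_⟩
      simp only [letter]
      rw [signPos_eq_of_mem κA.range rA hinvA ⟨c, rfl⟩ hm]
    · right
      exact ⟨Sum.inl _, 0, _, _, _, (good_inl κA κB _).2 hm, rfl, rfl, rfl, rfl, rfl,
        signPos_triple κA.range rA hlinA hinvA ⟨c, rfl⟩ hd hd' hm⟩
  · rw [good_inr] at hd hd'
    have e : (ev κA κB (Sum.inr b))⁻¹ * zc κA κB c * ev κA κB (Sum.inr b') =
        amalInr κA κB (b⁻¹ * κB c * b') := by simp [ev, ← amalInr_eq]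
    rw [e]
    by_cases hm : b⁻¹ * κB c * b' ∈ κB.range
    · left
      obtain ⟨c', hc'⟩ := id hm
      refine ⟨c', by rw [← hc', amalInr_eq], ?_⟩
      simp only [letter]
      rw [signPos_eq_of_mem κB.range rB hinvB ⟨c, rfl⟩ hm]
    · right
      exact ⟨Sum.inr _, 1, _, _, _, (good_inr κA κB _).2 hm, rfl, rfl, rfl, rfl, rfl,
        signPos_triple κB.range rB hlinB hinvB ⟨c, rfl⟩ hd hd' hm⟩

theorem WRep.of_normal {l : List (A ⊕ B)} (h : IsNormalForm κA κB l) :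
    WRep κA κB rA rB (prodOf κA κB l) (l.map (letter κA κB rA rB)) :=
  ⟨1, l, h, by rw [zc_one, one_mul], rfl⟩

include hlinA hlinB hinvA hinvB in
/-- Representatives of `(c g)⁻¹`. -/
theorem WRep.inv_aux {l : List (A ⊕ B)} (h : IsNormalForm κA κB l) (c : C) :
    WRep κA κB rA rB ((prodOf κA κB l)⁻¹ * zc κA κB c)
      (FreeGroup.invRev (l.map (letter κA κB rA rB))) := by
  rcases l with _ | ⟨d, t⟩
  · exact ⟨c, [], h, by simp [prodOf_nil], rfl⟩
  · have h' := normal_replace κA κB h (good_lact κA κB c⁻¹ (good_head κA κB h))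
      (lact_isLeft κA κB c⁻¹ d)
    have := WRep.of_normal κA κB rA rB (normal_Linv κA κB h')
    rw [prodOf_Linv, letters_Linv κA κB rA rB hlinA hlinB hinvA hinvB
      ((isNormalForm_iff κA κB _).1 h').2, prodOf_cons, List.map_cons, ev_lact,
      letter_lact κA κB rA rB hinvA hinvB] at this
    convert this using 1
    · rw [prodOf_cons, zc_inv]
      group
    · rw [List.map_cons]

include hlinA hlinB hinvA hinvB in
theorem WRep.inv {g : Amal κA κB} {x} (h : WRep κA κB rA rB g x) :
    WRep κA κB rA rB g⁻¹ (FreeGroup.invRev x) := by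
  obtain ⟨c, l, hl, rfl, rfl⟩ := h
  have := WRep.inv_aux κA κB rA rB hlinA hlinB hinvA hinvB hl c⁻¹
  convert this using 1
  rw [zc_inv]
  group

include hlinA hlinB hinvA hinvB in
/-- The main cancellation lemma. -/
theorem main_aux (l : List (A ⊕ B)) : ∀ (m : List (A ⊕ B)) (c : C), IsNormalForm κA κB l →
    IsNormalForm κA κB m →
    ∃ w, WRep κA κB rA rB ((prodOf κA κB l)⁻¹ * zc κA κB c * prodOf κA κB m) w ∧
      Tri (l.map (letter κA κB rA rB)) (m.map (letter κA κB rA rB)) w := by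
  induction l with
  | nil =>
    intro m c hl hm
    refine ⟨_, ⟨c, m, hm, by simp [prodOf_nil], rfl⟩, Or.inl ?_⟩
    rw [List.map_nil, ← FreeGroup.one_eq_mk]
    simp
  | cons d t ih =>
    intro m c hl hm
    rcases m with _ | ⟨d', t'⟩
    · have hr := WRep.inv_aux κA κB rA rB hlinA hlinB hinvA hinvB hl c
      refine ⟨_, (by rw [prodOf_nil, mul_one]; exact hr), Or.inl ?_⟩
      rw [List.map_nil, ← FreeGroup.one_eq_mk, FreeGroup.inv_mk, mul_one]
    by_cases hdd : d.isLeft = d'.isLeft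
    · rcases same_side κA κB rA rB hlinA hlinB hinvA hinvB c (good_head κA κB hl)
        (good_head κA κB hm) hdd with ⟨c', hc', hX⟩ |
          ⟨e, i, s, s', s'', hg, hside, heq, h1, h2, h3, h4⟩
      · obtain ⟨w, hw, htri⟩ := ih t' c' (normal_tail κA κB hl) (normal_tail κA κB hm)
        refine ⟨w, ?_, ?_⟩
        · convert hw using 1
          rw [← hc', prodOf_cons, prodOf_cons]
          group
        · rw [List.map_cons, List.map_cons, hX]
          exact htri.cons _
      · have n1 := normal_replace κA κB hl hg hside
        have n2 := normal_replace κA κB hm hg (hside.trans hdd)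
        have := WRep.of_normal κA κB rA rB (normal_join κA κB n1 n2)
        refine ⟨(Linv t ++ e :: t').map (letter κA κB rA rB), ?_, ?_⟩
        · convert this using 1
          rw [prodOf_append, prodOf_Linv, prodOf_cons, prodOf_cons, prodOf_cons, ← heq]
          group
        · refine Or.inr ⟨[], t.map (letter κA κB rA rB), t'.map (letter κA κB rA rB), i, s, s', s'',
            ?_, ?_, ?_, h4⟩
          · simp [h1]
          · simp [h2]
          · rw [List.map_append, letters_Linv κA κB rA rB hlinA hlinB hinvA hinvB
              ((isNormalForm_iff κA κB _).1 (normal_tail κA κB hl)).2, List.map_cons, h3]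
    · have hm' := normal_replace κA κB hm (good_lact κA κB c (good_head κA κB hm))
        (lact_isLeft κA κB c d')
      have := WRep.of_normal κA κB rA rB (normal_join' κA κB hl hm'
        (by rw [lact_isLeft]; exact hdd))
      refine ⟨(Linv (d :: t) ++ lact κA κB c d' :: t').map (letter κA κB rA rB), ?_, Or.inl ?_⟩
      · convert this using 1
        rw [prodOf_append, prodOf_Linv, prodOf_cons κA κB (lact κA κB c d'), ev_lact,
          prodOf_cons κA κB d']
        group
      · rw [List.map_append, letters_Linv κA κB rA rB hlinA hlinB hinvA hinvB
          ((isNormalForm_iff κA κB _).1 hl).2, List.map_cons (a := lact κA κB c d'),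
          letter_lact κA κB rA rB hinvA hinvB, ← FreeGroup.mul_mk, FreeGroup.inv_mk,
          List.map_cons (a := d')]

include hlinA hlinB hinvA hinvB in
theorem main_rep {g h : Amal κA κB} {x y} (hg : WRep κA κB rA rB g x)
    (hh : WRep κA κB rA rB h y) :
    ∃ w, WRep κA κB rA rB (g⁻¹ * h) w ∧ Tri x y w := by
  obtain ⟨c, l, hl, rfl, rfl⟩ := hg
  obtain ⟨c', m, hm, rfl, rfl⟩ := hh
  obtain ⟨w, hw, ht⟩ := main_aux κA κB rA rB hlinA hlinB hinvA hinvB l m (c⁻¹ * c') hl hm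
  refine ⟨w, ?_, ht⟩
  convert hw using 1
  rw [zc_mul, zc_inv]
  group

include hlinA hlinB hinvA hinvB in
theorem rep_exists (g : Amal κA κB) : ∃ x, WRep κA κB rA rB g x := by
  have single : ∀ d : A ⊕ B, Good κA κB d → ∃ x, WRep κA κB rA rB (ev κA κB d) x := by
    intro d hd
    have hn : IsNormalForm κA κB [d] := by
      rw [isNormalForm_iff]; simpa using hd
    exact ⟨_, by simpa [prodOf_cons, prodOf_nil] using WRep.of_normal κA κB rA rB hn⟩
  have base : ∀ c, WRep κA κB rA rB (zc κA κB c) [] := fun c =>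
    ⟨c, [], normal_nil κA κB, by simp [prodOf_nil], rfl⟩
  obtain ⟨g, rfl⟩ := QuotientGroup.mk_surjective g
  induction g using Coprod.induction_on with
  | inl a =>
    by_cases ha : a ∈ κA.range
    · obtain ⟨c, rfl⟩ := ha
      exact ⟨_, base c⟩
    · exact single (Sum.inl a) ((good_inl κA κB a).2 ha)
  | inr b =>
    by_cases hb : b ∈ κB.range
    · obtain ⟨c, rfl⟩ := hb
      refine ⟨[], ?_⟩
      have := base c
      rw [← amalInr_eq] at this
      exact this
    · exact single (Sum.inr b) ((good_inr κA κB b).2 hb)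
  | mul g h ihg ihh =>
    obtain ⟨x, hx⟩ := ihg
    obtain ⟨y, hy⟩ := ihh
    obtain ⟨w, hw, -⟩ := main_rep κA κB rA rB hlinA hlinB hinvA hinvB
      (hx.inv κA κB rA rB hlinA hlinB hinvA hinvB) hy
    refine ⟨w, ?_⟩
    have key : ∀ g h : Amal κA κB, WRep κA κB rA rB (g⁻¹⁻¹ * h) w →
        WRep κA κB rA rB (g * h) w := fun g h hw => by rwa [inv_inv] at hw
    exact key _ _ hw

include hlinA hlinB hinvA hinvB in
theorem rep_unique (hA : Function.Injective κA) (hB : Function.Injective κB)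
    {g : Amal κA κB} {x y} (hx : WRep κA κB rA rB g x) (hy : WRep κA κB rA rB g y) : x = y := by
  obtain ⟨w, hw, ht⟩ := main_rep κA κB rA rB hlinA hlinB hinvA hinvB hx hy
  rw [inv_mul_cancel] at hw
  obtain ⟨c, l, hl, h1, rfl⟩ := hw
  have : l = [] := by
    refine normalForm_eq_nil κA κB hA hB l hl c⁻¹ ?_
    change _ = zc κA κB c⁻¹
    rw [zc_inv]
    exact eq_inv_of_mul_eq_one_right h1.symm
  subst this
  rcases ht with ht | ⟨p, t, t', i, s, s', s'', -, -, h, -⟩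
  · rw [List.map_nil, ← FreeGroup.one_eq_mk, inv_mul_eq_one] at ht
    rw [← (hx.altL κA κB rA rB).toWord, ← (hy.altL κA κB rA rB).toWord, ht]
  · simp at h

end Main

/-- **Lemma.** Given `G`-invariant linear orders on `A/κ_A(C)` and `B/κ_B(C)`, the
normal-form sign map `Φ : A ★_C B → 𝒜` is well defined (independent of the chosen
normal form, i.e. it exists as a function computing the sign word on every normal
form and vanishing on the image of `C`) and is a letter-quasimorphism. -/
theorem amalgam_letterQM (κA : C →* A) (κB : C →* B)
    (hA : Function.Injective κA) (hB : Function.Injective κB)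
    (rA : A ⧸ κA.range → A ⧸ κA.range → Prop)
    (rB : B ⧸ κB.range → B ⧸ κB.range → Prop)
    (hlinA : IsLinearOrder _ rA) (hlinB : IsLinearOrder _ rB)
    (hinvA : ∀ (a : A) (x y : A ⧸ κA.range), rA x y → rA (a • x) (a • y))
    (hinvB : ∀ (b : B) (x y : B ⧸ κB.range), rB x y → rB (b • x) (b • y)) :
    ∃ Φ : Amal κA κB → W,
      (∀ c : C, Φ (amalInl κA κB (κA c)) = 1) ∧
      (∀ l : List (A ⊕ B), IsNormalForm κA κB l →
        Φ (prodOf κA κB l) = wordOf κA κB rA rB l) ∧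
      IsLetterQM Φ := by
  have ex := rep_exists κA κB rA rB hlinA hlinB hinvA hinvB
  choose f hf using ex
  have uniq : ∀ {g x}, WRep κA κB rA rB g x → f g = x := fun h =>
    rep_unique κA κB rA rB hlinA hlinB hinvA hinvB hA hB (hf _) h
  have finv : ∀ g, f g⁻¹ = FreeGroup.invRev (f g) := fun g =>
    uniq ((hf g).inv κA κB rA rB hlinA hlinB hinvA hinvB)
  have falt : ∀ g, AltL (f g) := fun g => (hf g).altL κA κB rA rB
  refine ⟨fun g => FreeGroup.mk (f g), ?_, ?_, ?_, ?_, ?_⟩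
  · intro c
    have : f (amalInl κA κB (κA c)) = [] :=
      uniq ⟨c, [], normal_nil κA κB, by simp [prodOf_nil, zc], rfl⟩
    simp only [this]
    rfl
  · intro l hl
    simp only [wordOf_eq, uniq (WRep.of_normal κA κB rA rB hl)]
  · intro g
    exact (falt g).mem
  · intro g
    simp only [finv, FreeGroup.inv_mk]
  · intro g h
    obtain ⟨w, hw, ht⟩ := main_rep κA κB rA rB hlinA hlinB hinvA hinvB (hf g⁻¹) (hf h)
    rw [inv_inv] at hw
    have hwe := uniq hw
    subst hwe
    rcases ht with ht | ⟨p, t, t', i, s, s', s'', h1, h2, h3, h4⟩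
    · left
      rw [finv, ← FreeGroup.inv_mk, inv_inv] at ht
      simp only [ht, mul_inv_cancel]
    · right
      have a1 := falt g⁻¹
      have a2 := falt h
      rw [h1] at a1
      rw [h2] at a2
      have ap := a1.left
      have at1 := a1.right.tail
      have at2 := a2.right.tail
      have hg : f g = FreeGroup.invRev t ++ [(i, !s)] ++ FreeGroup.invRev p := by
        have := finv g⁻¹
        rw [inv_inv, h1] at this
        rw [this, FreeGroup.invRev_append, FreeGroup.invRev_cons]
        simp [FreeGroup.invRev]
      refine ⟨i, !s, s', !s'', FreeGroup.mk t, (FreeGroup.mk p)⁻¹, FreeGroup.mk t', at1.mem, ?_,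
        at2.mem, h4, ?_, ?_, ?_⟩
      · rw [FreeGroup.inv_mk]; exact ap.invRev.mem
      · rw [(falt g).toWord, FreeGroup.toWord_inv, FreeGroup.toWord_inv, at1.toWord, ap.toWord, hg]
      · rw [(falt h).toWord, inv_inv, ap.toWord, at2.toWord, h2]
        simp
      · rw [FreeGroup.toWord_inv, FreeGroup.toWord_inv, (falt (g * h)).toWord, at1.toWord,
          at2.toWord, h3, FreeGroup.invRev_append, FreeGroup.invRev_cons, FreeGroup.invRev_invRev]
        simp [FreeGroup.invRev]
end
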